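/- Let T be a near-triangulation with boundary cycle C = (u_1, ..., u_h, u_1) and let u_i be a boundary vertex. If the graph T − {u_i}, obtained by deleting u_i and its incident edges, is isomorphic to H_1 or H_2, then T has a total dominating set of size 5 containing u_i. -/

import Mathlib

/-!
Common definitions.

A *plane graph* is a finite graph whose vertices are points of the plane `ℝ × ℝ` and whose
edges are drawn as straight-line segments between their endpoints (by Fáry's theorem every
planar graph admits such a drawing).  A *near-triangulation* is a plane graph that is properly
embedded, biconnected, and all of whose bounded faces are triangles (the faces are the
connected components of the complement of the drawing).  The boundary cycle lists, cyclically,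
the vertices on the outer (unbounded) face.
-/

open scoped Classical

noncomputable section

/-- A finite graph drawn in the plane: the vertices are points of `ℝ × ℝ` and each edge is
drawn as the straight-line segment between its endpoints. -/
structure PlaneGraph where
  verts : Finset (ℝ × ℝ)
  Adj : ℝ × ℝ → ℝ × ℝ → Prop
  symm : ∀ p q, Adj p q → Adj q p
  loopless : ∀ p, ¬ Adj p p
  mem_of_adj : ∀ p q, Adj p q → p ∈ verts ∧ q ∈ verts

namespace PlaneGraph

variable (G : PlaneGraph)

/-- The union of the (closed) segments realizing the edges of the graph. -/
def drawing : Set (ℝ × ℝ) := {x | ∃ p q, G.Adj p q ∧ x ∈ segment ℝ p q}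

/-- The straight-line drawing is a proper plane embedding: two edges meet only in common
endpoints and no vertex lies on an edge of which it is not an endpoint. -/
def IsEmbedded : Prop :=
  (∀ p q r s, G.Adj p q → G.Adj r s → ∀ x, x ∈ segment ℝ p q → x ∈ segment ℝ r s →
      ({p, q} : Set (ℝ × ℝ)) = {r, s} ∨
        (x ∈ ({p, q} : Set (ℝ × ℝ)) ∧ x ∈ ({r, s} : Set (ℝ × ℝ)))) ∧
  (∀ p q v, G.Adj p q → v ∈ G.verts → v ∈ segment ℝ p q → v = p ∨ v = q)

/-- Reachability by walks in the graph. -/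
def Reachable (p q : ℝ × ℝ) : Prop := Relation.ReflTransGen G.Adj p q

/-- The graph is connected. -/
def Connected : Prop := G.verts.Nonempty ∧ ∀ p ∈ G.verts, ∀ q ∈ G.verts, G.Reachable p q

/-- Deletion of a set of vertices together with all incident edges. -/
def deleteVerts (S : Finset (ℝ × ℝ)) : PlaneGraph where
  verts := G.verts \ S
  Adj := fun p q => G.Adj p q ∧ p ∉ S ∧ q ∉ S
  symm := fun p q h => ⟨G.symm p q h.1, h.2.2, h.2.1⟩
  loopless := fun p h => G.loopless p h.1
  mem_of_adj := fun p q h => by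
    obtain ⟨h1, h2⟩ := G.mem_of_adj p q h.1
    exact ⟨Finset.mem_sdiff.mpr ⟨h1, h.2.1⟩, Finset.mem_sdiff.mpr ⟨h2, h.2.2⟩⟩

/-- Deletion of a single edge (keeping all vertices). -/
def deleteEdge (p q : ℝ × ℝ) : PlaneGraph where
  verts := G.verts
  Adj := fun a b => G.Adj a b ∧ ¬ ((a = p ∧ b = q) ∨ (a = q ∧ b = p))
  symm := fun a b h => ⟨G.symm a b h.1, by tauto⟩
  loopless := fun a h => G.loopless a h.1
  mem_of_adj := fun a b h => G.mem_of_adj a b h.1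

/-- The (abstract, simple) graph obtained by contracting the edge `(p, q)`:
the vertex `q` is merged into `p`, which becomes the new contracted vertex. -/
def contractEdge (p q : ℝ × ℝ) : PlaneGraph where
  verts := G.verts.erase q
  Adj := fun a b =>
    a ≠ b ∧ a ∈ G.verts.erase q ∧ b ∈ G.verts.erase q ∧
      (G.Adj a b ∨ (a = p ∧ G.Adj q b) ∨ (b = p ∧ G.Adj q a))
  symm := fun a b h => by
    obtain ⟨h1, h2, h3, h4⟩ := h
    refine ⟨h1.symm, h3, h2, ?_⟩
    rcases h4 with h4 | h4 | h4
    · exact Or.inl (G.symm _ _ h4)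
    · exact Or.inr (Or.inr h4)
    · exact Or.inr (Or.inl h4)
  loopless := fun a h => h.1 rfl
  mem_of_adj := fun a b h => ⟨h.2.1, h.2.2.1⟩

/-- Biconnectivity: at least three vertices, connected, and deleting any single vertex leaves
a connected graph. -/
def Biconnected : Prop :=
  3 ≤ G.verts.card ∧ G.Connected ∧ ∀ v ∈ G.verts, (G.deleteVerts {v}).Connected

/-- A face of the plane graph: a connected component of the complement of the drawing. -/
def IsFace (F : Set (ℝ × ℝ)) : Prop :=
  ∃ x, x ∉ G.drawing ∧ F = connectedComponentIn G.drawingᶜ x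

/-- The open triangle with the three given corners. -/
def openTriangle (a b c : ℝ × ℝ) : Set (ℝ × ℝ) :=
  interior (convexHull ℝ ({a, b, c} : Set (ℝ × ℝ)))

/-- Every bounded (inner) face of the drawing is a triangular face of the graph. -/
def InnerFacesTriangles : Prop :=
  ∀ F, G.IsFace F → Bornology.IsBounded F →
    ∃ a ∈ G.verts, ∃ b ∈ G.verts, ∃ c ∈ G.verts,
      G.Adj a b ∧ G.Adj b c ∧ G.Adj a c ∧ F = openTriangle a b c

/-- A near-triangulation: a properly embedded biconnected plane graph all of whose faces are
triangles, except possibly the outer (unbounded) face. -/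
def IsNearTriangulation : Prop :=
  G.IsEmbedded ∧ G.Biconnected ∧ G.InnerFacesTriangles

/-- The outer region: the union of the unbounded components of the complement of the
drawing (for a near-triangulation this is the outer face). -/
def outerRegion : Set (ℝ × ℝ) :=
  {x | x ∉ G.drawing ∧ ¬ Bornology.IsBounded (connectedComponentIn G.drawingᶜ x)}

/-- `u : ZMod h → ℝ × ℝ` is the boundary cycle of `G`: an injective cyclic sequence
`u 0, u 1, …, u (h-1)` of vertices, consecutive ones adjacent, whose edges bound the outer
face and which contains every vertex lying on the boundary of the outer face. -/
def IsBoundaryCycle {h : ℕ} (u : ZMod h → ℝ × ℝ) : Prop :=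
  3 ≤ h ∧ Function.Injective u ∧
  (∀ i, u i ∈ G.verts) ∧
  (∀ i, G.Adj (u i) (u (i + 1))) ∧
  (∀ i, segment ℝ (u i) (u (i + 1)) ⊆ frontier G.outerRegion) ∧
  (∀ v ∈ G.verts, (v : ℝ × ℝ) ∈ frontier G.outerRegion → v ∈ Set.range u)

/-- An interior vertex: a vertex not on the boundary cycle. -/
def IsInteriorVtx {h : ℕ} (u : ZMod h → ℝ × ℝ) (v : ℝ × ℝ) : Prop :=
  v ∈ G.verts ∧ v ∉ Set.range u

/-- The edge `(p, q)` is a diagonal: it joins two non-consecutive boundary vertices. -/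
def IsDiagonalEdge {h : ℕ} (u : ZMod h → ℝ × ℝ) (p q : ℝ × ℝ) : Prop :=
  G.Adj p q ∧ ∃ i j : ZMod h, p = u i ∧ q = u j ∧ j ≠ i + 1 ∧ i ≠ j + 1

/-- The graph has no diagonals: any edge between boundary vertices joins consecutive ones. -/
def HasNoDiagonals {h : ℕ} (u : ZMod h → ℝ × ℝ) : Prop :=
  ∀ i j : ZMod h, G.Adj (u i) (u j) → j = i + 1 ∨ i = j + 1

/-- The degree of a vertex. -/
def degree (v : ℝ × ℝ) : ℕ := (G.verts.filter (fun w => G.Adj v w)).card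

/-- The degree of a vertex in the subgraph induced on the set `S` of vertices. -/
def degreeOn (S : Set (ℝ × ℝ)) (v : ℝ × ℝ) : ℕ :=
  (G.verts.filter (fun w => G.Adj v w ∧ w ∈ S)).card

/-- A total dominating set: every vertex of the graph is adjacent to a member of `D`. -/
def IsTDS (D : Finset (ℝ × ℝ)) : Prop :=
  D ⊆ G.verts ∧ ∀ v ∈ G.verts, ∃ d ∈ D, G.Adj v d

/-- The total domination number `γₜ`. -/
def totalDominationNumber : ℕ :=
  sInf {k | ∃ D : Finset (ℝ × ℝ), G.IsTDS D ∧ D.card = k}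

/-- Isomorphism of plane graphs as abstract graphs. -/
def IsIsoTo (H : PlaneGraph) : Prop :=
  ∃ f : ℝ × ℝ → ℝ × ℝ,
    Set.BijOn f (↑G.verts) (↑H.verts) ∧
    ∀ p ∈ G.verts, ∀ q ∈ G.verts, (G.Adj p q ↔ H.Adj (f p) (f q))

/-- The edge `(p, q)` is contractible: the contracted graph `G/e` is (abstractly isomorphic
to) a near-triangulation. -/
def IsContractible (p q : ℝ × ℝ) : Prop :=
  G.Adj p q ∧ ∃ H : PlaneGraph, H.IsNearTriangulation ∧ (G.contractEdge p q).IsIsoTo H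

/-- A separating triangle: a triangle of the graph with some vertex strictly inside it and
some vertex outside it. -/
def IsSeparatingTriangle (a b c : ℝ × ℝ) : Prop :=
  a ∈ G.verts ∧ b ∈ G.verts ∧ c ∈ G.verts ∧
  G.Adj a b ∧ G.Adj b c ∧ G.Adj a c ∧
  (∃ v ∈ G.verts, v ∈ openTriangle a b c) ∧
  (∃ v ∈ G.verts, v ∉ convexHull ℝ ({a, b, c} : Set (ℝ × ℝ)))

/-- Edge list of the first exceptional 12-vertex maximal outerplanar graph `H₁`
(boundary 12-cycle, central triangle `{0,4,8}`, ear triangles `{1,2,3}`, `{5,6,7}`,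
`{9,10,11}`, and the three remaining quadrilateral diagonals, all with the same
orientation). -/
def exc1Edges : List (Fin 12 × Fin 12) :=
  [(0,1),(1,2),(2,3),(3,4),(4,5),(5,6),(6,7),(7,8),(8,9),(9,10),(10,11),(11,0),
   (0,4),(4,8),(0,8),(1,3),(5,7),(9,11),(0,3),(4,7),(8,11)]

/-- Edge list of the second exceptional 12-vertex maximal outerplanar graph `H₂`
(same as `H₁` except that one quadrilateral diagonal has the opposite orientation). -/
def exc2Edges : List (Fin 12 × Fin 12) :=
  [(0,1),(1,2),(2,3),(3,4),(4,5),(5,6),(6,7),(7,8),(8,9),(9,10),(10,11),(11,0),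
   (0,4),(4,8),(0,8),(1,3),(5,7),(9,11),(0,3),(4,7),(0,9)]

/-- The exceptional graph `H₁`. -/
def H1graph : SimpleGraph (Fin 12) := SimpleGraph.fromRel (fun a b => (a, b) ∈ exc1Edges)

/-- The exceptional graph `H₂`. -/
def H2graph : SimpleGraph (Fin 12) := SimpleGraph.fromRel (fun a b => (a, b) ∈ exc2Edges)

/-- Isomorphism between a plane graph and a simple graph on `Fin 12`. -/
def IsIsoToSG (H : SimpleGraph (Fin 12)) : Prop :=
  ∃ f : ℝ × ℝ → Fin 12,
    Set.BijOn f (↑G.verts) Set.univ ∧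
    ∀ p ∈ G.verts, ∀ q ∈ G.verts, (G.Adj p q ↔ H.Adj (f p) (f q))

/-- `G` is isomorphic to `H₁` or to `H₂`. -/
def IsExceptional : Prop := G.IsIsoToSG H1graph ∨ G.IsIsoToSG H2graph

/-- A maximal outerplanar graph (MOP): a near-triangulation all of whose vertices lie on the
boundary cycle. -/
def IsMOP : Prop :=
  G.IsNearTriangulation ∧
    ∃ (h : ℕ) (u : ZMod h → ℝ × ℝ), G.IsBoundaryCycle u ∧ ∀ v ∈ G.verts, v ∈ Set.range u

/-- The graph is Hamiltonian: it has a cycle through all of its vertices. -/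
def IsHamiltonian : Prop :=
  ∃ (m : ℕ) (c : ZMod m → ℝ × ℝ), 3 ≤ m ∧ Function.Injective c ∧
    (∀ i, G.Adj (c i) (c (i + 1))) ∧ ∀ v ∈ G.verts, v ∈ Set.range c

/-- An outerplane graph: a properly embedded plane graph all of whose vertices lie on the
boundary of the outer region. -/
def IsOuterplane : Prop :=
  G.IsEmbedded ∧ ∀ v ∈ G.verts, (v : ℝ × ℝ) ∈ closure G.outerRegion

/-- The union of the boundary-cycle segments. -/
def boundaryDrawing {h : ℕ} (u : ZMod h → ℝ × ℝ) : Set (ℝ × ℝ) :=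
  ⋃ i : ZMod h, segment ℝ (u i) (u (i + 1))

/-- The open interior of the boundary cycle, viewed as a simple closed polygon. -/
def polygonInterior {h : ℕ} (u : ZMod h → ℝ × ℝ) : Set (ℝ × ℝ) :=
  {x | x ∉ boundaryDrawing u ∧
    Bornology.IsBounded (connectedComponentIn (boundaryDrawing u)ᶜ x)}

/-- The union of the segments realizing the diagonals of `G[C]`. -/
def diagonalDrawing {h : ℕ} (u : ZMod h → ℝ × ℝ) : Set (ℝ × ℝ) :=
  {x | ∃ i j : ZMod h, G.Adj (u i) (u j) ∧ j ≠ i + 1 ∧ i ≠ j + 1 ∧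
    x ∈ segment ℝ (u i) (u j)}

/-- A region of the subdivision of the interior of the boundary cycle by the diagonals of
`G[C]`: a connected component of the interior of the cycle minus the diagonals. -/
def IsSubdivisionRegion {h : ℕ} (u : ZMod h → ℝ × ℝ) (R : Set (ℝ × ℝ)) : Prop :=
  ∃ x ∈ polygonInterior u \ G.diagonalDrawing u,
    R = connectedComponentIn (polygonInterior u \ G.diagonalDrawing u) x

/-- The diagonal `(u i, u j)` is a side of the region `R`. -/
def IsSideOf {h : ℕ} (u : ZMod h → ℝ × ℝ) (R : Set (ℝ × ℝ)) (i j : ZMod h) : Prop :=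
  G.Adj (u i) (u j) ∧ j ≠ i + 1 ∧ i ≠ j + 1 ∧
    segment ℝ (u i) (u j) \ {u i, u j} ⊆ frontier R

/-- `v` lies on the opposite side of the diagonal `(u i, u j)` from the region `R`:
inside the boundary polygon, `v` cannot be joined to `R` without crossing the diagonal. -/
def OppositeSideOf {h : ℕ} (u : ZMod h → ℝ × ℝ) (R : Set (ℝ × ℝ)) (i j : ZMod h)
    (v : ℝ × ℝ) : Prop :=
  ∀ x ∈ R, v ∉ connectedComponentIn (polygonInterior u \ segment ℝ (u i) (u j)) x

/-- A terminal polygon: a region of the subdivision containing some interior vertex such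
that at most one of its sides has interior vertices of `G` on its opposite side
(i.e. at most one of the outer parts `T_out(P,d)` contains interior vertices). -/
def IsTerminalPolygon {h : ℕ} (u : ZMod h → ℝ × ℝ) (R : Set (ℝ × ℝ)) : Prop :=
  G.IsSubdivisionRegion u R ∧
  (∃ v, G.IsInteriorVtx u v ∧ v ∈ R) ∧
  ∀ i j k l : ZMod h,
    G.IsSideOf u R i j → G.IsSideOf u R k l →
    (∃ w, G.IsInteriorVtx u w ∧ OppositeSideOf u R i j w) →
    (∃ w, G.IsInteriorVtx u w ∧ OppositeSideOf u R k l w) →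
    ({u i, u j} : Set (ℝ × ℝ)) = {u k, u l}

/-- An irreducible near-triangulation: it has interior vertices, and for every boundary edge
`(u i, u (i+1))` the third vertex of the inner triangular face containing this edge also lies
on the boundary cycle. -/
def Irreducible {h : ℕ} (u : ZMod h → ℝ × ℝ) : Prop :=
  (∃ v, G.IsInteriorVtx u v) ∧
  ∀ i : ZMod h, ∀ v ∈ G.verts,
    G.Adj (u i) v → G.Adj (u (i + 1)) v →
    G.IsFace (openTriangle (u i) (u (i + 1)) v) → v ∈ Set.range u

end PlaneGraph

namespace PlaneGraph

open Filter Topology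

/-! ### Triangles in the plane -/

/-- The determinant of two vectors of the plane. -/
def cross (a b : ℝ × ℝ) : ℝ := a.1 * b.2 - a.2 * b.1

theorem mem_convexHull_triple {a b c y : ℝ × ℝ} :
    y ∈ convexHull ℝ ({a, b, c} : Set (ℝ × ℝ)) ↔
      ∃ α β γ : ℝ, 0 ≤ α ∧ 0 ≤ β ∧ 0 ≤ γ ∧ α + β + γ = 1 ∧ α • a + β • b + γ • c = y := by
  rw [← convexJoin_segment_singleton, mem_convexJoin]
  constructor
  · rintro ⟨z, ⟨s, t, hs, ht, hst, rfl⟩, _, rfl, k, l, hk, hl, hkl, rfl⟩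
    refine ⟨k * s, k * t, l, by positivity, by positivity, hl, ?_, ?_⟩
    · rw [← mul_add, hst, mul_one, hkl]
    · simp only [smul_add, smul_smul]
  · rintro ⟨α, β, γ, hα, hβ, hγ, hsum, rfl⟩
    rcases (add_nonneg hα hβ).eq_or_lt with h0 | h0
    · have h1 : α = 0 := by linarith
      have h2 : β = 0 := by linarith
      have h3 : γ = 1 := by linarith
      subst h1 h2 h3
      exact ⟨a, left_mem_segment ℝ a b, c, rfl, by simpa using right_mem_segment ℝ a c⟩
    · refine ⟨(α / (α + β)) • a + (β / (α + β)) • b,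
        ⟨_, _, by positivity, by positivity, by field_simp, rfl⟩, c, rfl,
        α + β, γ, h0.le, hγ, hsum, ?_⟩
      simp only [smul_add, smul_smul]
      rw [mul_div_cancel₀ _ h0.ne', mul_div_cancel₀ _ h0.ne']

/-- A vector is expanded in the basis `p`, `q` by the rule of Cramer. -/
theorem cross_smul_eq (p q z : ℝ × ℝ) :
    cross p q • z = cross z q • p + cross p z • q := by
  ext <;> simp [cross] <;> ring

theorem mem_segment_of_mem_convexHull_of_notMem_interior {a b c y : ℝ × ℝ}
    (hD : cross (b - a) (c - a) ≠ 0)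
    (hy : y ∈ convexHull ℝ ({a, b, c} : Set (ℝ × ℝ)))
    (hi : y ∉ interior (convexHull ℝ ({a, b, c} : Set (ℝ × ℝ)))) :
    y ∈ segment ℝ a b ∨ y ∈ segment ℝ b c ∨ y ∈ segment ℝ a c := by
  obtain ⟨α, β, γ, hα, hβ, hγ, hsum, rfl⟩ := mem_convexHull_triple.1 hy
  rcases hα.eq_or_lt with rfl | hα
  · exact .inr (.inl ⟨β, γ, hβ, hγ, by linarith, by simp⟩)
  rcases hβ.eq_or_lt with rfl | hβ
  · exact .inr (.inr ⟨α, γ, hα.le, hγ, by linarith, by simp⟩)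
  rcases hγ.eq_or_lt with rfl | hγ
  · exact .inl ⟨α, β, hα.le, hβ.le, by linarith, by simp⟩
  refine absurd ?_ hi
  set D := cross (b - a) (c - a)
  let f : ℝ × ℝ → ℝ := fun z => cross (z - a) (c - a) / D
  let g : ℝ × ℝ → ℝ := fun z => cross (b - a) (z - a) / D
  have hf : Continuous f := by unfold f cross; fun_prop
  have hg : Continuous g := by unfold g cross; fun_prop
  have hexp : ∀ z, z = (1 - f z - g z) • a + f z • b + g z • c := by
    intro z
    have h := cross_smul_eq (b - a) (c - a) (z - a)
    have h' : z - a = f z • (b - a) + g z • (c - a) := by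
      have := congrArg (fun v => D⁻¹ • v) h
      simp only [smul_add, smul_smul] at this
      rw [inv_mul_cancel₀ hD, one_smul] at this
      rw [this]; simp only [f, g, div_eq_inv_mul, D]
    generalize f z = s at *
    generalize g z = t at *
    rw [sub_eq_iff_eq_add] at h'
    rw [h']
    module
  rw [mem_interior_iff_mem_nhds]
  have hfy : f (α • a + β • b + γ • c) = β := by
    simp only [f]
    rw [div_eq_iff hD]
    obtain rfl : α = 1 - β - γ := by linarith
    simp [D, cross]; ring
  have hgy : g (α • a + β • b + γ • c) = γ := by
    simp only [g]
    rw [div_eq_iff hD]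
    obtain rfl : α = 1 - β - γ := by linarith
    simp [D, cross]; ring
  have h1 := (continuous_const.tendsto' _ _ rfl).eventually_lt hf.continuousAt (hβ.trans_eq hfy.symm)
  have h2 := (continuous_const.tendsto' _ _ rfl).eventually_lt hg.continuousAt (hγ.trans_eq hgy.symm)
  have h3 : ∀ᶠ z in 𝓝 (α • a + β • b + γ • c), f z + g z < 1 :=
    (hf.add hg).continuousAt.eventually_lt (continuous_const.tendsto' _ 1 rfl)
      (show f _ + g _ < 1 by rw [hfy, hgy]; linarith)
  filter_upwards [h1, h2, h3] with z h1 h2 h3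
  exact mem_convexHull_triple.2
    ⟨1 - f z - g z, f z, g z, by linarith, h1.le, h2.le, by ring, (hexp z).symm⟩

theorem cross_of_mem_segment {a b z : ℝ × ℝ} (h : z ∈ segment ℝ a b) :
    cross (b - a) (z - a) = 0 := by
  obtain ⟨s, t, -, -, hst, rfl⟩ := h
  obtain rfl : s = 1 - t := by linarith
  simp [cross]; ring

theorem cross_mul_nonneg_of_mem_convexHull {a b c y : ℝ × ℝ}
    (hy : y ∈ convexHull ℝ ({a, b, c} : Set (ℝ × ℝ))) :
    0 ≤ cross (b - a) (y - a) * cross (b - a) (c - a) := by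
  obtain ⟨α, β, γ, hα, hβ, hγ, hsum, rfl⟩ := mem_convexHull_triple.1 hy
  obtain rfl : α = 1 - β - γ := by linarith
  have : cross (b - a) ((1 - β - γ) • a + β • b + γ • c - a) = γ * cross (b - a) (c - a) := by
    simp [cross]; ring
  rw [this, mul_assoc]
  exact mul_nonneg hγ (mul_self_nonneg _)

theorem isClosed_convexHull_triple (a b c : ℝ × ℝ) :
    IsClosed (convexHull ℝ ({a, b, c} : Set (ℝ × ℝ))) :=
  ((Set.toFinite _).isCompact_convexHull (𝕜 := ℝ)).isClosed

theorem isClosed_segment_prod (a b : ℝ × ℝ) : IsClosed (segment ℝ a b) := by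
  rw [← convexHull_pair]
  exact ((Set.toFinite _).isCompact_convexHull (𝕜 := ℝ)).isClosed

theorem eventually_mem_imp_mem {K : Set (ℝ × ℝ)} (hK : IsClosed K) (x : ℝ × ℝ) :
    ∀ᶠ y in 𝓝 x, y ∈ K → x ∈ K := by
  by_cases hx : x ∈ K
  · exact Eventually.of_forall fun _ _ => hx
  · filter_upwards [hK.isOpen_compl.mem_nhds hx] with y hy h using absurd h hy

/-! ### Embedded plane graphs -/

variable {G : PlaneGraph}

theorem IsEmbedded.cross_ne_zero (hG : G.IsEmbedded) {a b c : ℝ × ℝ} (hab : G.Adj a b)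
    (hbc : G.Adj b c) (hac : G.Adj a c) : cross (b - a) (c - a) ≠ 0 := by
  have nab : a ≠ b := fun h => G.loopless _ (h ▸ hab)
  have nbc : b ≠ c := fun h => G.loopless _ (h ▸ hbc)
  have nac : a ≠ c := fun h => G.loopless _ (h ▸ hac)
  intro h0
  have hcol : Collinear ℝ ({a, b, c} : Set (ℝ × ℝ)) := by
    rw [collinear_iff_of_mem (p₀ := a) (by simp)]
    refine ⟨b - a, ?_⟩
    have hne : b - a ≠ 0 := sub_ne_zero.2 nab.symm
    have hsq : (b - a).1 ^ 2 + (b - a).2 ^ 2 ≠ 0 := by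
      intro h
      apply hne
      ext <;> simp only [Prod.fst_zero, Prod.snd_zero] <;>
        nlinarith [sq_nonneg (b - a).1, sq_nonneg (b - a).2]
    rintro p (rfl | rfl | rfl)
    · exact ⟨0, by simp⟩
    · exact ⟨1, by simp⟩
    · refine ⟨((b - a).1 * (p - a).1 + (b - a).2 * (p - a).2) /
        ((b - a).1 ^ 2 + (b - a).2 ^ 2), ?_⟩
      simp only [vadd_eq_add]
      rw [← sub_eq_iff_eq_add]
      have : cross (b - a) (p - a) = 0 := h0
      generalize b - a = u at *
      generalize p - a = v at *
      unfold cross at this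
      ext
      · simp only [Prod.smul_fst, smul_eq_mul]
        field_simp
        linear_combination -u.2 * this
      · simp only [Prod.smul_snd, smul_eq_mul]
        field_simp
        linear_combination u.1 * this
  have hv {p q} (h : G.Adj p q) := G.mem_of_adj p q h
  rcases hcol.wbtw_or_wbtw_or_wbtw with h | h | h <;> rw [← mem_segment_iff_wbtw] at h
  · rcases hG.2 _ _ _ hac (hv hab).2 h with h | h
    exacts [nab h.symm, nbc h]
  · rcases hG.2 _ _ _ (G.symm _ _ hab) (hv hbc).2 h with h | h
    exacts [nbc h.symm, nac h.symm]
  · rcases hG.2 _ _ _ (G.symm _ _ hbc) (hv hab).1 h with h | h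
    exacts [nac h, nab h]

theorem segment_subset_drawing {p q : ℝ × ℝ} (h : G.Adj p q) : segment ℝ p q ⊆ G.drawing :=
  fun _ hx => ⟨p, q, h, hx⟩

/-- The outer region avoids every closed triangle of the graph. -/
theorem IsEmbedded.notMem_outerRegion (hG : G.IsEmbedded) {a b c y : ℝ × ℝ} (hab : G.Adj a b)
    (hbc : G.Adj b c) (hac : G.Adj a c)
    (hy : y ∈ convexHull ℝ ({a, b, c} : Set (ℝ × ℝ))) : y ∉ G.outerRegion := by
  rintro ⟨hyd, hub⟩
  apply hub
  have hsub : convexHull ℝ ({a, b, c} : Set (ℝ × ℝ)) ⊆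
      interior (convexHull ℝ ({a, b, c} : Set (ℝ × ℝ))) ∪ G.drawing := by
    intro z hz
    by_cases hi : z ∈ interior (convexHull ℝ ({a, b, c} : Set (ℝ × ℝ)))
    · exact .inl hi
    · rcases mem_segment_of_mem_convexHull_of_notMem_interior
        (hG.cross_ne_zero hab hbc hac) hz hi with h | h | h
      exacts [.inr (segment_subset_drawing hab h), .inr (segment_subset_drawing hbc h),
        .inr (segment_subset_drawing hac h)]
  refine Bornology.IsBounded.subset
    ((Set.toFinite ({a, b, c} : Set (ℝ × ℝ))).isCompact_convexHull (𝕜 := ℝ)).isBounded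
    (Set.Subset.trans ?_ interior_subset)
  refine isPreconnected_connectedComponentIn.subset_left_of_subset_union isOpen_interior
    (isClosed_convexHull_triple a b c).isOpen_compl
    (disjoint_compl_right.mono_left interior_subset) ?_ ?_
  · intro z hz
    have hzd : z ∉ G.drawing := connectedComponentIn_subset _ _ hz
    by_cases hzK : z ∈ convexHull ℝ ({a, b, c} : Set (ℝ × ℝ))
    · exact .inl ((hsub hzK).resolve_right hzd)
    · exact .inr hzK
  · exact ⟨y, mem_connectedComponentIn hyd, (hsub hy).resolve_right hyd⟩

theorem eventually_mem_segment (G : PlaneGraph) (x : ℝ × ℝ) :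
    ∀ᶠ y in 𝓝 x, ∀ p q, G.Adj p q → y ∈ segment ℝ p q → x ∈ segment ℝ p q := by
  have : ∀ᶠ y in 𝓝 x, ∀ p ∈ G.verts, ∀ q ∈ G.verts,
      y ∈ segment ℝ p q → x ∈ segment ℝ p q := by
    simp only [eventually_all_finset]
    exact fun p _ q _ => eventually_mem_imp_mem (isClosed_segment_prod p q) x
  filter_upwards [this] with y hy p q h
  exact hy p (G.mem_of_adj p q h).1 q (G.mem_of_adj p q h).2

theorem eventually_mem_convexHull (G : PlaneGraph) (x : ℝ × ℝ) :
    ∀ᶠ y in 𝓝 x, ∀ a ∈ G.verts, ∀ b ∈ G.verts, ∀ c ∈ G.verts,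
      y ∈ convexHull ℝ ({a, b, c} : Set (ℝ × ℝ)) →
        x ∈ convexHull ℝ ({a, b, c} : Set (ℝ × ℝ)) := by
  simp only [eventually_all_finset]
  exact fun a _ b _ c _ => eventually_mem_imp_mem (isClosed_convexHull_triple a b c) x

/-- An edge that belongs to at most one triangle of the graph borders the outer region. -/
theorem IsEmbedded.openSegment_subset_closure_outerRegion (hG : G.IsEmbedded)
    (hF : G.InnerFacesTriangles) {w p : ℝ × ℝ} (hwp : G.Adj w p)
    (huniq : ∀ c c', G.Adj w c → G.Adj p c → G.Adj w c' → G.Adj p c' → c = c') :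
    openSegment ℝ w p ⊆ closure G.outerRegion := by
  intro x hx
  have nwp : w ≠ p := fun h => G.loopless _ (h ▸ hwp)
  have hxs : x ∈ segment ℝ w p := openSegment_subset_segment ℝ w p hx
  have hxw : x ≠ w := by
    rintro rfl; exact nwp (left_mem_openSegment_iff.1 hx)
  have hxp : x ≠ p := by
    rintro rfl; exact nwp (right_mem_openSegment_iff.1 hx)
  have honly : ∀ a b, G.Adj a b → x ∈ segment ℝ a b → (a = w ∧ b = p) ∨ (a = p ∧ b = w) := by
    intro a b hab hxab
    rcases hG.1 w p a b hwp hab x hxs hxab with h | h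
    · rcases Set.pair_eq_pair_iff.1 h with ⟨rfl, rfl⟩ | ⟨rfl, rfl⟩ <;> simp
    · rcases h.1 with h | h
      exacts [absurd h hxw, absurd h hxp]
  obtain ⟨n, hn0, hn⟩ : ∃ n : ℝ × ℝ, cross (p - w) n ≠ 0 ∧
      ∀ c, G.Adj w c → G.Adj p c → cross (p - w) n * cross (p - w) (c - w) < 0 := by
    by_cases hc : ∃ c, G.Adj w c ∧ G.Adj p c
    · obtain ⟨c, h1, h2⟩ := hc
      have hD := hG.cross_ne_zero hwp h2 h1
      have hneg : cross (p - w) (-(c - w)) = -cross (p - w) (c - w) := by simp [cross]; ring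
      refine ⟨-(c - w), by rw [hneg]; exact neg_ne_zero.2 hD, fun c' h1' h2' => ?_⟩
      obtain rfl := huniq c c' h1 h2 h1' h2'
      rw [hneg, neg_mul, neg_lt_zero]
      exact mul_self_pos.2 hD
    · push Not at hc
      refine ⟨(-(p - w).2, (p - w).1), fun h => nwp ?_, fun c h1 h2 => absurd h2 (hc c h1)⟩
      simp only [cross] at h
      have h1 : (p - w).1 = 0 := by nlinarith [sq_nonneg (p - w).1, sq_nonneg (p - w).2]
      have h2 : (p - w).2 = 0 := by nlinarith [sq_nonneg (p - w).1, sq_nonneg (p - w).2]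
      exact (sub_eq_zero.1 (Prod.ext h1 h2)).symm
  rw [mem_closure_iff_frequently]
  intro hev
  have htend : Tendsto (fun s : ℝ => x + s • n) (𝓝[>] 0) (𝓝 x) := by
    have : Continuous fun s : ℝ => x + s • n := by fun_prop
    exact (this.tendsto' 0 x (by simp)).mono_left nhdsWithin_le_nhds
  obtain ⟨s, ⟨⟨h1, h2⟩, h3⟩, hs⟩ := ((htend.eventually
    ((hev.and (eventually_mem_segment G x)).and (eventually_mem_convexHull G x))).and
      self_mem_nhdsWithin).exists
  set y := x + s • n
  have hs : 0 < s := hs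
  have hycross : cross (p - w) (y - w) = s * cross (p - w) n := by
    have := cross_of_mem_segment hxs
    simp only [cross, y, Prod.fst_sub, Prod.snd_sub, Prod.fst_add, Prod.snd_add, Prod.smul_fst,
      Prod.smul_snd, smul_eq_mul] at this ⊢
    linear_combination this
  have hyd : y ∉ G.drawing := by
    rintro ⟨a, b, hab, hyab⟩
    have : y ∈ segment ℝ w p := by
      rcases honly a b hab (h2 a b hab hyab) with ⟨rfl, rfl⟩ | ⟨rfl, rfl⟩
      · exact hyab
      · rwa [segment_symm]
    exact mul_ne_zero hs.ne' hn0 (hycross ▸ cross_of_mem_segment this)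
  have hbd : Bornology.IsBounded (connectedComponentIn G.drawingᶜ y) := by
    by_contra hb; exact h1 ⟨hyd, hb⟩
  obtain ⟨a, ha, b, hb, c, hc, hab, hbc, hac, hT⟩ := hF _ ⟨y, hyd, rfl⟩ hbd
  have hyT : y ∈ convexHull ℝ ({a, b, c} : Set (ℝ × ℝ)) :=
    interior_subset (show y ∈ openTriangle a b c from hT ▸ mem_connectedComponentIn hyd)
  have hxT := h3 a ha b hb c hc hyT
  have hxi : x ∉ interior (convexHull ℝ ({a, b, c} : Set (ℝ × ℝ))) := by
    intro h
    have : x ∈ connectedComponentIn G.drawingᶜ y := by rw [hT]; exact h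
    exact connectedComponentIn_subset _ _ this (segment_subset_drawing hwp hxs)
  obtain ⟨r, hwr, hpr, hyr⟩ : ∃ r, G.Adj w r ∧ G.Adj p r ∧
      y ∈ convexHull ℝ ({w, p, r} : Set (ℝ × ℝ)) := by
    have key : ∀ a b c, G.Adj a b → G.Adj b c → G.Adj a c → x ∈ segment ℝ a b →
        y ∈ convexHull ℝ ({a, b, c} : Set (ℝ × ℝ)) → ∃ r, G.Adj w r ∧ G.Adj p r ∧
          y ∈ convexHull ℝ ({w, p, r} : Set (ℝ × ℝ)) := by
      intro a b c hab hbc hac hx hy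
      rcases honly a b hab hx with ⟨rfl, rfl⟩ | ⟨rfl, rfl⟩
      · exact ⟨c, hac, hbc, hy⟩
      · exact ⟨c, hbc, hac, by rwa [Set.insert_comm]⟩
    rcases mem_segment_of_mem_convexHull_of_notMem_interior
      (hG.cross_ne_zero hab hbc hac) hxT hxi with h | h | h
    · exact key a b c hab hbc hac h hyT
    · refine key b c a hbc (G.symm _ _ hac) (G.symm _ _ hab) h ?_
      rwa [Set.pair_comm c a, Set.insert_comm]
    · exact key a c b hac (G.symm _ _ hbc) hab h (by rwa [Set.pair_comm c b])
  have h4 := cross_mul_nonneg_of_mem_convexHull hyr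
  rw [hycross, mul_assoc] at h4
  exact absurd h4 (not_le.2 (mul_neg_of_pos_of_neg hs (hn r hwr hpr)))

/-! ### Rotation at a vertex -/

/-- `p` and `q` span a triangle of the graph together with `w`. -/
def Linked (G : PlaneGraph) (w p q : ℝ × ℝ) : Prop := G.Adj w p ∧ G.Adj w q ∧ G.Adj p q

/-- A point of the outer region close to `w` is not seen from `w` in the direction of a point
of the edge opposite to `w` in a triangle. -/
theorem IsEmbedded.notMem_outerRegion_of_smul (hG : G.IsEmbedded) {w p q y z : ℝ × ℝ}
    (hnear : ∀ t : ℝ, 0 ≤ t → t ≤ 1 → ∀ p q, G.Adj p q → w + t • (y - w) ∈ segment ℝ p q →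
      w ∈ segment ℝ p q)
    (hpq : G.Linked w p q) (hz : z ∈ segment ℝ p q) {t : ℝ} (ht : 0 < t)
    (h : y - w = t • (z - w)) : y ∉ G.outerRegion := by
  obtain ⟨hwp, hwq, hpq⟩ := hpq
  have hw : w ∉ segment ℝ p q := by
    intro hw
    rcases hG.2 p q w hpq (G.mem_of_adj _ _ hwp).1 hw with rfl | rfl
    exacts [G.loopless _ hwp, G.loopless _ hwq]
  refine hG.notMem_outerRegion hwp hpq hwq ?_
  have ht1 : t ≤ 1 := by
    by_contra! ht1
    refine hw (hnear t⁻¹ (by positivity) (inv_le_one_of_one_le₀ ht1.le) p q hpq ?_)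
    rwa [h, smul_smul, inv_mul_cancel₀ ht.ne', one_smul, add_sub_cancel]
  obtain ⟨α, β, hα, hβ, hαβ, rfl⟩ := hz
  refine mem_convexHull_triple.2 ⟨1 - t, t * α, t * β, by linarith, by positivity,
    by positivity, by rw [add_assoc, ← mul_add, hαβ]; ring, ?_⟩
  rw [sub_eq_iff_eq_add] at h
  rw [h]
  module

/-- The triangles at a vertex `w` leave at most one gap, so among any three pairwise connected
edges at `w` one does not border the outer region. -/
theorem IsEmbedded.not_three_outer (hG : G.IsEmbedded) {w : ℝ × ℝ} (p : Fin 3 → ℝ × ℝ)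
    (hp : Function.Injective p) (hwp : ∀ i, G.Adj w (p i))
    (hlink : ∀ i j, Relation.ReflTransGen (G.Linked w) (p i) (p j))
    (hout : ∀ i, openSegment ℝ w (p i) ⊆ closure G.outerRegion) : False := by
  obtain ⟨r, hr, hball⟩ := Metric.eventually_nhds_iff_ball.1 (eventually_mem_segment G w)
  have hshrink : ∀ y ∈ Metric.ball w r, ∀ t : ℝ, 0 ≤ t → t ≤ 1 →
      w + t • (y - w) ∈ Metric.ball w r := by
    intro y hy t h0 h1
    exact (convex_ball w r).add_smul_sub_mem (Metric.mem_ball_self hr) hy ⟨h0, h1⟩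
  have hcone : ∀ y ∈ Metric.ball w r, y ∈ G.outerRegion → ∀ a b z, G.Linked w a b →
      z ∈ segment ℝ a b → ∀ t : ℝ, 0 < t → y - w ≠ t • (z - w) := by
    intro y hy hyo a b z hab hz t ht h
    exact hG.notMem_outerRegion_of_smul
      (fun t h0 h1 => hball _ (hshrink y hy t h0 h1)) hab hz ht h hyo
  have hx : ∀ i, ∃ x ∈ Metric.ball w r, x ∈ closure G.outerRegion ∧
      ∃ t : ℝ, 0 < t ∧ x - w = t • (p i - w) := by
    intro i
    have htend : Tendsto (fun t : ℝ => w + t • (p i - w)) (𝓝[>] 0) (𝓝 w) := by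
      have : Continuous fun s : ℝ => w + s • (p i - w) := by fun_prop
      exact (this.tendsto' 0 w (by simp)).mono_left nhdsWithin_le_nhds
    obtain ⟨t, h1, ht0, ht1⟩ := ((htend.eventually (Metric.ball_mem_nhds w hr)).and
      (Ioo_mem_nhdsGT (zero_lt_one (α := ℝ)))).exists
    refine ⟨_, h1, hout i ?_, t, ht0, by simp⟩
    exact ⟨1 - t, t, by linarith, ht0, by ring, by module⟩
  choose x hxb hxc hxt using hx
  obtain ⟨y₀, hy₀b, hy₀⟩ := mem_closure_iff_nhds.1 (hxc 0) _ (Metric.isOpen_ball.mem_nhds (hxb 0))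
  -- The argument of the direction from `w`, cut along the direction of `y₀`.
  let e : (ℝ × ℝ) ≃L[ℝ] ℂ := Complex.equivRealProdCLM.symm
  let f : ℝ × ℝ → ℝ := fun z => Complex.arg (-(e (z - w) / e (y₀ - w)))
  have hwd : w ∈ G.drawing := ⟨w, p 0, hwp 0, left_mem_segment ℝ _ _⟩
  have hne : ∀ y, y ∈ G.outerRegion → e (y - w) ≠ 0 := by
    rintro y hy h
    rw [map_eq_zero_iff e e.injective, sub_eq_zero] at h
    exact hy.1 (h ▸ hwd)
  have hf_smul : ∀ z z' : ℝ × ℝ, ∀ t : ℝ, 0 < t → z - w = t • (z' - w) → f z = f z' := by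
    intro z z' t ht h
    simp only [f]
    rw [h, map_smul, Complex.real_smul, mul_div_assoc, ← mul_neg, Complex.arg_real_mul _ ht]
  have hf_eq : ∀ z z' : ℝ × ℝ, e (z - w) ≠ 0 → e (z' - w) ≠ 0 → f z = f z' →
      ∃ t : ℝ, 0 < t ∧ z - w = t • (z' - w) := by
    intro z z' hz hz' h
    have h0 := hne y₀ hy₀
    have hA : -(e (z - w) / e (y₀ - w)) ≠ 0 := neg_ne_zero.2 (div_ne_zero hz h0)
    have hB : -(e (z' - w) / e (y₀ - w)) ≠ 0 := neg_ne_zero.2 (div_ne_zero hz' h0)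
    have := (Complex.arg_eq_arg_iff hB hA).1 h.symm
    refine ⟨‖-(e (z - w) / e (y₀ - w))‖ / ‖-(e (z' - w) / e (y₀ - w))‖,
      div_pos (norm_pos_iff.2 hA) (norm_pos_iff.2 hB), e.injective ?_⟩
    rw [map_smul, Complex.real_smul, Complex.ofReal_div]
    rw [mul_neg, neg_inj, ← mul_div_assoc, div_left_inj' h0] at this
    exact this.symm
  have hf_cont : ∀ z, (∀ t : ℝ, 0 < t → y₀ - w ≠ t • (z - w)) → e (z - w) ≠ 0 →
      ContinuousAt f z := by
    intro z hz hz0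
    have hs : -(e (z - w) / e (y₀ - w)) ∈ Complex.slitPlane := by
      by_contra hs
      rw [Complex.mem_slitPlane_iff] at hs
      push Not at hs
      set q := e (z - w) / e (y₀ - w) with hq
      have hq0 : q ≠ 0 := div_ne_zero hz0 (hne y₀ hy₀)
      have him : q.im = 0 := by simpa using hs.2
      have hre : 0 ≤ q.re := by simpa using hs.1
      have hqr : q = (q.re : ℂ) := Complex.ext rfl (by simp [him])
      have hre : 0 < q.re := hre.lt_of_ne' fun h => hq0 (by rw [hqr, h, Complex.ofReal_zero])
      refine hz q.re⁻¹ (by positivity) (e.injective ?_)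
      rw [map_smul, Complex.real_smul, Complex.ofReal_inv, ← hqr, hq]
      field_simp [hz0, hne y₀ hy₀]
    refine (Complex.continuousAt_arg hs).comp (f := fun z => -(e (z - w) / e (y₀ - w))) ?_
    have : Continuous fun z => -(e (z - w) / e (y₀ - w)) := by fun_prop
    exact this.continuousAt
  let Z : Set (ℝ × ℝ) := {z | ∃ a b, G.Linked w a b ∧ z ∈ segment ℝ a b}
  have hZ0 : ∀ z ∈ Z, e (z - w) ≠ 0 := by
    rintro z ⟨a, b, ⟨h1, h2, h3⟩, hz⟩ h
    rw [map_eq_zero_iff e e.injective, sub_eq_zero] at h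
    subst h
    rcases hG.2 a b z h3 (G.mem_of_adj _ _ h1).1 hz with rfl | rfl
    exacts [G.loopless _ h1, G.loopless _ h2]
  have hcontZ : ∀ z ∈ Z, ContinuousAt f z := by
    rintro z hz
    obtain ⟨a, b, hab, hzs⟩ := id hz
    exact hf_cont z (hcone y₀ hy₀b hy₀ a b z hab hzs) (hZ0 z hz)
  have hstep : ∀ a b, G.Linked w a b → Set.uIcc (f a) (f b) ⊆ f '' Z := by
    intro a b hab
    have hsub : segment ℝ a b ⊆ Z := fun z hz => ⟨a, b, hab, hz⟩
    have hpre : IsPreconnected (f '' segment ℝ a b) :=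
      (convex_segment a b).isPreconnected.image f fun z hz =>
        (hcontZ z (hsub hz)).continuousWithinAt
    exact (hpre.ordConnected.uIcc_subset ⟨a, left_mem_segment ℝ a b, rfl⟩
      ⟨b, right_mem_segment ℝ a b, rfl⟩).trans (Set.image_mono hsub)
  have hpZ : ∀ i, p i ∈ Z := by
    intro i
    obtain ⟨j, hj⟩ : ∃ j : Fin 3, j ≠ i := exists_ne i
    rcases (hlink i j).cases_head with h | ⟨c, hc, -⟩
    · exact absurd (hp h).symm hj
    · exact ⟨p i, c, hc, left_mem_segment ℝ _ _⟩
  have hall : ∀ i j, Set.uIcc (f (p i)) (f (p j)) ⊆ f '' Z := by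
    intro i j
    have h := hlink i j
    generalize p j = b at h ⊢
    induction h with
    | refl => rw [Set.uIcc_self, Set.singleton_subset_iff]; exact ⟨p i, hpZ i, rfl⟩
    | tail _ hbc ih =>
      exact Set.uIcc_subset_uIcc_union_uIcc.trans (Set.union_subset ih (hstep _ _ hbc))
  have hfp : Function.Injective fun i => f (p i) := by
    intro i j hij
    by_contra hne'
    obtain ⟨t, ht, h⟩ := hf_eq _ _ (hZ0 _ (hpZ i)) (hZ0 _ (hpZ j)) hij
    have key : ∀ i j, i ≠ j → ∀ t : ℝ, 0 < t → t ≤ 1 → p i - w ≠ t • (p j - w) := by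
      intro i j hne' t ht ht1 h
      rw [sub_eq_iff_eq_add] at h
      rcases hG.2 w (p j) (p i) (hwp j) (G.mem_of_adj _ _ (hwp i)).2
        ⟨1 - t, t, by linarith, ht.le, by ring, by rw [h]; module⟩ with h | h
      · exact G.loopless w (by simpa [h] using hwp i)
      · exact hne' (hp h)
    rcases le_total t 1 with h1 | h1
    · exact key i j hne' t ht h1 h
    · exact key j i (Ne.symm hne') t⁻¹ (by positivity) (inv_le_one_of_one_le₀ h1)
        (by rw [h, smul_smul, inv_mul_cancel₀ ht.ne', one_smul])
  have hmid : ∀ i j k, f (p i) < f (p j) → f (p j) < f (p k) → False := by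
    intro i j k hij hjk
    obtain ⟨t, ht, hxt⟩ := hxt j
    obtain ⟨a, b, hab, hjs⟩ := hpZ j
    have hxZ : e (x j - w) ≠ 0 := by
      rw [hxt, map_smul]; exact smul_ne_zero ht.ne' (hZ0 _ (hpZ j))
    have hfx := hf_smul _ _ t ht hxt
    have hc : ContinuousAt f (x j) := by
      refine hf_cont _ (fun s hs h => ?_) hxZ
      rw [hxt, smul_smul] at h
      exact hcone y₀ hy₀b hy₀ a b _ hab hjs (s * t) (by positivity) h
    have hev := hc.eventually (Ioo_mem_nhds (hfx.symm ▸ hij) (hfx.symm ▸ hjk))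
    obtain ⟨y, ⟨hyI, hyb⟩, hyo⟩ := mem_closure_iff_nhds.1 (hxc j) _
      (inter_mem hev (Metric.isOpen_ball.mem_nhds (hxb j)))
    obtain ⟨z, ⟨c, d, hcd, hz⟩, hzf⟩ := hall i k
      (Set.Icc_subset_uIcc (Set.Ioo_subset_Icc_self hyI))
    obtain ⟨s, hs, h⟩ := hf_eq y z (hne y hyo) (hZ0 z ⟨c, d, hcd, hz⟩) hzf.symm
    exact hcone y hyb hyo c d z hcd hz s hs h
  have h01 := hfp.ne (show (0 : Fin 3) ≠ 1 by decide)
  have h02 := hfp.ne (show (0 : Fin 3) ≠ 2 by decide)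
  have h12 := hfp.ne (show (1 : Fin 3) ≠ 2 by decide)
  rcases h01.lt_or_gt with h | h <;> rcases h02.lt_or_gt with h' | h' <;>
    rcases h12.lt_or_gt with h'' | h''
  · exact hmid 0 1 2 h h''
  · exact hmid 0 2 1 h' h''
  · exact hmid 0 1 2 h h''
  · exact hmid 2 0 1 h' h
  · exact hmid 1 0 2 h h'
  · exact hmid 1 0 2 h h'
  · exact hmid 1 2 0 h'' h'
  · exact hmid 2 1 0 h'' h

/-! ### Deleting a boundary vertex -/

theorem reflTransGen_of_isChain {α : Type*} {r : α → α → Prop} (hr : ∀ a b, r a b → r b a)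
    {l : List α} (hl : l.IsChain r) {a b : α} (ha : a ∈ l) (hb : b ∈ l) :
    Relation.ReflTransGen r a b := by
  have : Std.Symm r := ⟨hr⟩
  have hl' : l.Pairwise (Relation.ReflTransGen r) :=
    List.isChain_iff_pairwise.1 (hl.imp fun _ _ h => Relation.ReflTransGen.single h)
  by_cases hab : a = b
  · rw [hab]
  · exact hl'.forall ha hb hab

/-- Suppose deleting the boundary vertex `u i` leaves a graph `H` with a clique `S` such that each
`x ∉ S` belongs to a set of size 4 totally dominating `H - x`, while two edges from each `w ∈ S`
to the complement of `S` lie in a single triangle and are connected to `S` by triangles at `w`.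
Then there is a total dominating set of size 5 containing `u i`. -/
theorem exists_TDS_of_isIsoToSG_deleteVerts {H : SimpleGraph (Fin 12)} (S : Finset (Fin 12))
    (hclique : ∀ a ∈ S, ∀ b ∈ S, a ≠ b → H.Adj a b)
    (hdom : ∀ x ∉ S, ∃ D : Finset (Fin 12), x ∈ D ∧ D.card = 4 ∧
      ∀ y, y ≠ x → ∃ d ∈ D, H.Adj y d)
    (hlink : ∀ w ∈ S, ∃ l : List (Fin 12), l.IsChain H.Adj ∧ (∀ a ∈ l, H.Adj w a) ∧
      (∀ b ∈ S, b ≠ w → b ∈ l) ∧ ∃ e₁ ∈ l, ∃ e₂ ∈ l, e₁ ≠ e₂ ∧ ∀ e, e = e₁ ∨ e = e₂ →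
        e ∉ S ∧ ∀ c c', H.Adj w c → H.Adj e c → H.Adj w c' → H.Adj e c' → c = c')
    {h : ℕ} {u : ZMod h → ℝ × ℝ} {i : ZMod h} (hG : G.IsNearTriangulation)
    (hu : G.IsBoundaryCycle u) (hH : (G.deleteVerts {u i}).IsIsoToSG H) :
    ∃ D : Finset (ℝ × ℝ), G.IsTDS D ∧ D.card = 5 ∧ u i ∈ D := by
  obtain ⟨h3, huinj, huv, huadj, hufr, -⟩ := hu
  set v := u i with hv
  obtain ⟨f, hf, hfadj⟩ := hH
  have hmem : ∀ p, p ∈ (G.deleteVerts {v}).verts ↔ p ∈ G.verts ∧ p ≠ v := by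
    simp [deleteVerts]
  have hex : ∀ a, ∃ p, (p ∈ G.verts ∧ p ≠ v) ∧ f p = a := by
    intro a
    obtain ⟨p, hp, hpa⟩ := hf.2.2 (Set.mem_univ a)
    exact ⟨p, (hmem p).1 hp, hpa⟩
  choose g hg hfg using hex
  have hgf : ∀ p ∈ G.verts, p ≠ v → ∃ a, g a = p := fun p hp hpv =>
    ⟨f p, hf.2.1 ((hmem _).2 (hg _)) ((hmem _).2 ⟨hp, hpv⟩) (hfg _)⟩
  have hginj : Function.Injective g := fun a b hab => by rw [← hfg a, hab, hfg]
  have hgadj : ∀ a b, G.Adj (g a) (g b) ↔ H.Adj a b := by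
    intro a b
    have := hfadj _ ((hmem _).2 (hg a)) _ ((hmem _).2 (hg b))
    rw [hfg, hfg] at this
    rw [← this]
    simp [deleteVerts, (hg a).2, (hg b).2]
  by_cases hx : ∃ x ∉ S, G.Adj v (g x)
  · obtain ⟨x, hxS, hxv⟩ := hx
    obtain ⟨D, hxD, hcard, hD⟩ := hdom x hxS
    have hvD : v ∉ D.map ⟨g, hginj⟩ := by
      intro hvD
      obtain ⟨a, -, ha⟩ := Finset.mem_map.1 hvD
      exact (hg a).2 ha
    refine ⟨insert v (D.map ⟨g, hginj⟩), ⟨?_, ?_⟩, ?_, Finset.mem_insert_self _ _⟩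
    · refine Finset.insert_subset (huv i) fun p hp => ?_
      obtain ⟨a, -, rfl⟩ := Finset.mem_map.1 hp
      exact (hg a).1
    · intro p hp
      by_cases hpv : p = v
      · exact ⟨g x, Finset.mem_insert_of_mem (Finset.mem_map_of_mem _ hxD), hpv ▸ hxv⟩
      obtain ⟨y, rfl⟩ := hgf p hp hpv
      by_cases hyx : y = x
      · exact ⟨v, Finset.mem_insert_self _ _, hyx ▸ G.symm _ _ hxv⟩
      obtain ⟨d, hd, hyd⟩ := hD y hyx
      exact ⟨g d, Finset.mem_insert_of_mem (Finset.mem_map_of_mem _ hd), (hgadj _ _).2 hyd⟩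
    · rw [Finset.card_insert_of_notMem hvD, Finset.card_map, hcard]
  exfalso
  push Not at hx
  have hnb : ∀ p, G.Adj v p → ∃ a ∈ S, g a = p := by
    intro p hp
    obtain ⟨a, rfl⟩ := hgf p (G.mem_of_adj _ _ hp).2 fun h => G.loopless v (by rwa [h] at hp)
    exact ⟨a, by_contra fun ha => hx a ha hp, rfl⟩
  obtain ⟨w, hwS, hw⟩ := hnb _ (huadj i)
  have hpred : G.Adj v (u (i - 1)) := G.symm _ _ (by simpa using huadj (i - 1))
  obtain ⟨b, hbS, hb⟩ := hnb _ hpred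
  have hvw : G.Adj v (g w) := hw ▸ huadj i
  have hvb : G.Adj v (g b) := hb ▸ hpred
  have hbw : b ≠ w := by
    rintro rfl
    have h2 : ((2 : ℕ) : ZMod h) = 0 := by
      have := huinj (hb.symm.trans hw)
      push_cast
      linear_combination -this
    have := Nat.le_of_dvd two_pos ((ZMod.natCast_eq_zero_iff _ _).1 h2)
    omega
  obtain ⟨l, hl, hlw, hSl, e₁, he₁, e₂, he₂, hne, he⟩ := hlink w hwS
  have hlinked : ∀ a ∈ l, ∀ c ∈ l, Relation.ReflTransGen (G.Linked (g w)) (g a) (g c) := by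
    intro a ha c hc
    have hchain : l.IsChain fun a c => G.Linked (g w) (g a) (g c) := by
      refine hl.imp_of_mem_imp fun a c ha hc hac => ?_
      exact ⟨(hgadj _ _).2 (hlw a ha), (hgadj _ _).2 (hlw c hc), (hgadj _ _).2 hac⟩
    refine (reflTransGen_of_isChain (fun a c h => ?_) hchain ha hc).lift g fun _ _ h => h
    exact ⟨h.2.1, h.1, G.symm _ _ h.2.2⟩
  have hwb : G.Adj (g w) (g b) := (hgadj _ _).2 (hclique w hwS b hbS hbw.symm)
  have hlv : ∀ a ∈ l, Relation.ReflTransGen (G.Linked (g w)) (g a) v ∧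
      Relation.ReflTransGen (G.Linked (g w)) v (g a) := fun a ha =>
    ⟨(hlinked a ha b (hSl b hbS hbw)).tail ⟨hwb, G.symm _ _ hvw, G.symm _ _ hvb⟩,
      (hlinked b (hSl b hbS hbw) a ha).head ⟨G.symm _ _ hvw, hwb, hvb⟩⟩
  have hout : ∀ e ∈ l,
      (e ∉ S ∧ ∀ c c', H.Adj w c → H.Adj e c → H.Adj w c' → H.Adj e c' → c = c') →
      openSegment ℝ (g w) (g e) ⊆ closure G.outerRegion := by
    intro e hel ⟨heS, huniq⟩
    refine hG.1.openSegment_subset_closure_outerRegion hG.2.2 ((hgadj _ _).2 (hlw e hel)) ?_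
    have hc : ∀ c, G.Adj (g e) c → ∃ a, g a = c := fun c hec =>
      hgf c (G.mem_of_adj _ _ hec).2 fun h => hx e heS (G.symm _ _ (h ▸ hec))
    intro c c' h1 h2 h3 h4
    obtain ⟨a, rfl⟩ := hc c h2
    obtain ⟨a', rfl⟩ := hc c' h4
    rw [hgadj] at h1 h2 h3 h4
    rw [huniq a a' h1 h2 h3 h4]
  have houtv : openSegment ℝ (g w) v ⊆ closure G.outerRegion := by
    rw [openSegment_symm, hw]
    exact (openSegment_subset_segment ℝ _ _).trans ((hufr i).trans frontier_subset_closure)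
  refine hG.1.not_three_outer (w := g w) ![g e₁, g e₂, v] ?_ ?_ ?_ ?_
  · intro a c hac
    have h12 := hginj.ne hne
    fin_cases a <;> fin_cases c
    exacts [rfl, (h12 hac).elim, ((hg e₁).2 hac).elim, (h12 hac.symm).elim, rfl,
      ((hg e₂).2 hac).elim, ((hg e₁).2 hac.symm).elim, ((hg e₂).2 hac.symm).elim, rfl]
  · intro a
    fin_cases a
    exacts [(hgadj _ _).2 (hlw _ he₁), (hgadj _ _).2 (hlw _ he₂), G.symm _ _ hvw]
  · intro a c
    fin_cases a <;> fin_cases c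
    exacts [hlinked _ he₁ _ he₁, hlinked _ he₁ _ he₂, (hlv _ he₁).1, hlinked _ he₂ _ he₁,
      hlinked _ he₂ _ he₂, (hlv _ he₂).1, (hlv _ he₁).2, (hlv _ he₂).2, .refl]
  · intro a
    fin_cases a
    exacts [hout _ he₁ (he _ (Or.inl rfl)), hout _ he₂ (he _ (Or.inr rfl)), houtv]

theorem H1graph_adj (a b : Fin 12) :
    H1graph.Adj a b ↔ a ≠ b ∧ ((a, b) ∈ exc1Edges ∨ (b, a) ∈ exc1Edges) :=
  SimpleGraph.fromRel_adj _ _ _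

theorem H2graph_adj (a b : Fin 12) :
    H2graph.Adj a b ↔ a ≠ b ∧ ((a, b) ∈ exc2Edges ∨ (b, a) ∈ exc2Edges) :=
  SimpleGraph.fromRel_adj _ _ _

instance : DecidableRel H1graph.Adj := fun a b => decidable_of_iff' _ (H1graph_adj a b)

instance : DecidableRel H2graph.Adj := fun a b => decidable_of_iff' _ (H2graph_adj a b)

end PlaneGraph

/-- Let `T` be a near-triangulation with boundary cycle
`C = (u_1, …, u_h, u_1)` and let `u_i` be a boundary vertex.  If `T − {u_i}` is isomorphic to
`H₁` or `H₂`, then `T` has a total dominating set of size 5 containing `u_i`. -/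
theorem TDS_of_deleteVert_exceptional (T : PlaneGraph) (h : ℕ) (u : ZMod h → ℝ × ℝ)
    (i : ZMod h) (hT : T.IsNearTriangulation) (hu : T.IsBoundaryCycle u)
    (hexc : (T.deleteVerts {u i}).IsExceptional) :
    ∃ D : Finset (ℝ × ℝ), T.IsTDS D ∧ D.card = 5 ∧ u i ∈ D := by
  rcases hexc with hexc | hexc
  · refine PlaneGraph.exists_TDS_of_isIsoToSG_deleteVerts {0, 4, 8} (by decide) ?_ ?_ hT hu hexc
    · have key : ∀ x ∉ ({0, 4, 8} : Finset (Fin 12)),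
          ∃ D ∈ [{x, 7, 8, 9}, {x, 0, 1, 11}, ({x, 3, 4, 5} : Finset (Fin 12))], x ∈ D ∧
          D.card = 4 ∧ ∀ y, y ≠ x → ∃ d ∈ D, PlaneGraph.H1graph.Adj y d := by
        decide
      exact fun x hx => (key x hx).imp fun D hD => hD.2
    · simp only [Finset.mem_insert, Finset.mem_singleton, forall_eq_or_imp, forall_eq]
      refine ⟨⟨[1, 3, 4, 8, 11], by decide, by decide, by decide, 1, by decide, 11, ?_⟩,
        ⟨[3, 0, 8, 7, 5], by decide, by decide, by decide, 3, by decide, 5, ?_⟩,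
        ⟨[7, 4, 0, 11, 9], by decide, by decide, by decide, 7, by decide, 9, ?_⟩⟩ <;> decide
  · refine PlaneGraph.exists_TDS_of_isIsoToSG_deleteVerts {0, 4, 8} (by decide) ?_ ?_ hT hu hexc
    · have key : ∀ x ∉ ({0, 4, 8} : Finset (Fin 12)),
          ∃ D ∈ [{x, 7, 8, 9}, {x, 0, 1, 9}, ({x, 3, 4, 5} : Finset (Fin 12))], x ∈ D ∧
          D.card = 4 ∧ ∀ y, y ≠ x → ∃ d ∈ D, PlaneGraph.H2graph.Adj y d := by
        decide
      exact fun x hx => (key x hx).imp fun D hD => hD.2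
    · simp only [Finset.mem_insert, Finset.mem_singleton, forall_eq_or_imp, forall_eq]
      refine ⟨⟨[1, 3, 4, 8, 9, 11], by decide, by decide, by decide, 1, by decide, 11, ?_⟩,
        ⟨[3, 0, 8, 7, 5], by decide, by decide, by decide, 3, by decide, 5, ?_⟩,
        ⟨[7, 4, 0, 9], by decide, by decide, by decide, 7, by decide, 9, ?_⟩⟩ <;> decide
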